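/- arXiv:2110.02576 — 2 statements merged into one kernel-verified Lean document; each statement's English description precedes it below -/
import Mathlib

section
/- (1) PA(K) proves x = y → □(x = y). (2) For any formula φ(x) of the language of modal arithmetic, PA(K) proves x = y → (φ(x) → φ(y)). -/
namespace ModalArith

/-- Terms of the language of arithmetic L_A = {0, S, +, ×, ≤, =}. -/
inductive Term : Type
  | var : ℕ → Term
  | zero : Term
  | succ : Term → Term
  | add : Term → Term → Term
  | mul : Term → Term → Term
  deriving DecidableEq

namespace Term

/-- Free variables of a term. -/
def fv : Term → Finset ℕ
  | var x => {x}
  | zero => ∅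
  | succ t => fv t
  | add t u => fv t ∪ fv u
  | mul t u => fv t ∪ fv u

/-- Simultaneous substitution of terms for variables. -/
def substAll : Term → (ℕ → Term) → Term
  | var x, v => v x
  | zero, _ => zero
  | succ t, v => succ (substAll t v)
  | add t u, v => add (substAll t v) (substAll u v)
  | mul t u, v => mul (substAll t v) (substAll u v)

/-- Substitution of the term `s` for the variable `x`. -/
def subst (x : ℕ) (s : Term) (t : Term) : Term :=
  substAll t (Function.update Term.var x s)

/-- The numeral `n̄`. -/
def numeral : ℕ → Term
  | 0 => zero
  | n + 1 => succ (numeral n)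

/-- Value of a term in the standard model under a valuation. -/
def val : Term → (ℕ → ℕ) → ℕ
  | var x, v => v x
  | zero, _ => 0
  | succ t, v => val t v + 1
  | add t u, v => val t v + val u v
  | mul t u, v => val t v * val u v

/-- A Gödel numbering of terms. -/
def code : Term → ℕ
  | var x => Nat.pair 0 x
  | zero => Nat.pair 1 0
  | succ t => Nat.pair 2 (code t)
  | add t u => Nat.pair 3 (Nat.pair (code t) (code u))
  | mul t u => Nat.pair 4 (Nat.pair (code t) (code u))

end Term

/-- Formulas of the language L_□ of modal arithmetic. -/
inductive Formula : Type
  | falsum : Formula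
  | eq : Term → Term → Formula
  | le : Term → Term → Formula
  | and : Formula → Formula → Formula
  | or : Formula → Formula → Formula
  | imp : Formula → Formula → Formula
  | neg : Formula → Formula
  | all : ℕ → Formula → Formula
  | ex : ℕ → Formula → Formula
  | box : Formula → Formula
  deriving DecidableEq

namespace Formula

/-- Free variables of a formula. -/
def fv : Formula → Finset ℕ
  | falsum => ∅
  | eq t u => t.fv ∪ u.fv
  | le t u => t.fv ∪ u.fv
  | and φ ψ => fv φ ∪ fv ψ
  | or φ ψ => fv φ ∪ fv ψ
  | imp φ ψ => fv φ ∪ fv ψ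
  | neg φ => fv φ
  | all x φ => (fv φ).erase x
  | ex x φ => (fv φ).erase x
  | box φ => fv φ

/-- Simultaneous substitution of terms for the free variables of a formula. -/
def substAll : Formula → (ℕ → Term) → Formula
  | falsum, _ => falsum
  | eq t u, v => eq (t.substAll v) (u.substAll v)
  | le t u, v => le (t.substAll v) (u.substAll v)
  | and φ ψ, v => and (substAll φ v) (substAll ψ v)
  | or φ ψ, v => or (substAll φ v) (substAll ψ v)
  | imp φ ψ, v => imp (substAll φ v) (substAll ψ v)
  | neg φ, v => neg (substAll φ v)
  | all x φ, v => all x (substAll φ (Function.update v x (Term.var x)))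
  | ex x φ, v => ex x (substAll φ (Function.update v x (Term.var x)))
  | box φ, v => box (substAll φ v)

/-- Substitution of the term `s` for the free occurrences of the variable `x`. -/
def subst (x : ℕ) (s : Term) (φ : Formula) : Formula :=
  substAll φ (Function.update Term.var x s)

/-- The term `s` is substitutable (free) for the variable `x` in the formula. -/
def freeFor (s : Term) (x : ℕ) : Formula → Prop
  | falsum => True
  | eq _ _ => True
  | le _ _ => True
  | and φ ψ => freeFor s x φ ∧ freeFor s x ψ
  | or φ ψ => freeFor s x φ ∧ freeFor s x ψ
  | imp φ ψ => freeFor s x φ ∧ freeFor s x ψ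
  | neg φ => freeFor s x φ
  | all y φ => x = y ∨ x ∉ fv φ ∨ (y ∉ s.fv ∧ freeFor s x φ)
  | ex y φ => x = y ∨ x ∉ fv φ ∨ (y ∉ s.fv ∧ freeFor s x φ)
  | box φ => freeFor s x φ

/-- The formula is an L_A-formula (contains no □). -/
def noBox : Formula → Prop
  | falsum => True
  | eq _ _ => True
  | le _ _ => True
  | and φ ψ => noBox φ ∧ noBox ψ
  | or φ ψ => noBox φ ∧ noBox ψ
  | imp φ ψ => noBox φ ∧ noBox ψ
  | neg φ => noBox φ
  | all _ φ => noBox φ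
  | ex _ φ => noBox φ
  | box _ => False

/-- Truth in the standard model ℕ under a valuation (meaningful for L_A-formulas;
boxed formulas are given the dummy value `False`). -/
def val : Formula → (ℕ → ℕ) → Prop
  | falsum, _ => False
  | eq t u, v => t.val v = u.val v
  | le t u, v => t.val v ≤ u.val v
  | and φ ψ, v => val φ v ∧ val ψ v
  | or φ ψ, v => val φ v ∨ val ψ v
  | imp φ ψ, v => val φ v → val ψ v
  | neg φ, v => ¬ val φ v
  | all x φ, v => ∀ n : ℕ, val φ (Function.update v x n)
  | ex x φ, v => ∃ n : ℕ, val φ (Function.update v x n)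
  | box _, _ => False

/-- Biconditional, as an abbreviation. -/
def iff (φ ψ : Formula) : Formula := (φ.imp ψ).and (ψ.imp φ)

/-- `t < u` abbreviates `S t ≤ u`. -/
def lt (t u : Term) : Formula := le (Term.succ t) u

/-- Bounded universal quantification `∀ x < t, φ`. -/
def ball (x : ℕ) (t : Term) (φ : Formula) : Formula :=
  all x ((lt (Term.var x) t).imp φ)

/-- Bounded existential quantification `∃ x < t, φ`. -/
def bex (x : ℕ) (t : Term) (φ : Formula) : Formula :=
  ex x ((lt (Term.var x) t).and φ)

/-- A Gödel numbering of formulas. -/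
def code : Formula → ℕ
  | falsum => Nat.pair 0 0
  | eq t u => Nat.pair 1 (Nat.pair t.code u.code)
  | le t u => Nat.pair 2 (Nat.pair t.code u.code)
  | and φ ψ => Nat.pair 3 (Nat.pair (code φ) (code ψ))
  | or φ ψ => Nat.pair 4 (Nat.pair (code φ) (code ψ))
  | imp φ ψ => Nat.pair 5 (Nat.pair (code φ) (code ψ))
  | neg φ => Nat.pair 6 (code φ)
  | all x φ => Nat.pair 7 (Nat.pair x (code φ))
  | ex x φ => Nat.pair 8 (Nat.pair x (code φ))
  | box φ => Nat.pair 9 (code φ)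

end Formula

/-- A sentence is a formula with no free variables. -/
def Sentence (φ : Formula) : Prop := φ.fv = ∅

/-- Truth in the standard model ℕ (for sentences; any fixed valuation will do). -/
def StdTrue (φ : Formula) : Prop := φ.val fun _ => 0

/-- The logical axioms of classical first-order logic with equality for L_□,
with the identity axioms only for atomic formulas. -/
inductive LogicalAxiom : Formula → Prop
  | imp1 (φ ψ : Formula) : LogicalAxiom (φ.imp (ψ.imp φ))
  | imp2 (φ ψ χ : Formula) :
      LogicalAxiom ((φ.imp (ψ.imp χ)).imp ((φ.imp ψ).imp (φ.imp χ)))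
  | dne (φ : Formula) : LogicalAxiom (φ.neg.neg.imp φ)
  | negI (φ ψ : Formula) : LogicalAxiom ((φ.imp ψ).imp ((φ.imp ψ.neg).imp φ.neg))
  | negE (φ ψ : Formula) : LogicalAxiom (φ.neg.imp (φ.imp ψ))
  | falsumE (φ : Formula) : LogicalAxiom (Formula.falsum.imp φ)
  | negIntro (φ : Formula) : LogicalAxiom ((φ.imp Formula.falsum).imp φ.neg)
  | negElimFalsum (φ : Formula) : LogicalAxiom (φ.neg.imp (φ.imp Formula.falsum))
  | andI (φ ψ : Formula) : LogicalAxiom (φ.imp (ψ.imp (φ.and ψ)))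
  | andE1 (φ ψ : Formula) : LogicalAxiom ((φ.and ψ).imp φ)
  | andE2 (φ ψ : Formula) : LogicalAxiom ((φ.and ψ).imp ψ)
  | orI1 (φ ψ : Formula) : LogicalAxiom (φ.imp (φ.or ψ))
  | orI2 (φ ψ : Formula) : LogicalAxiom (ψ.imp (φ.or ψ))
  | orE (φ ψ χ : Formula) :
      LogicalAxiom ((φ.imp χ).imp ((ψ.imp χ).imp ((φ.or ψ).imp χ)))
  | allE (x : ℕ) (t : Term) (φ : Formula) :
      φ.freeFor t x → LogicalAxiom ((Formula.all x φ).imp (φ.subst x t))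
  | allImp (x : ℕ) (φ ψ : Formula) :
      x ∉ φ.fv → LogicalAxiom ((Formula.all x (φ.imp ψ)).imp (φ.imp (Formula.all x ψ)))
  | exI (x : ℕ) (t : Term) (φ : Formula) :
      φ.freeFor t x → LogicalAxiom ((φ.subst x t).imp (Formula.ex x φ))
  | exE (x : ℕ) (φ ψ : Formula) :
      x ∉ ψ.fv → LogicalAxiom ((Formula.all x (φ.imp ψ)).imp ((Formula.ex x φ).imp ψ))
  | eqRefl (t : Term) : LogicalAxiom (Formula.eq t t)
  | eqSymm (t u : Term) : LogicalAxiom ((Formula.eq t u).imp (Formula.eq u t))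
  | eqTrans (t u w : Term) :
      LogicalAxiom ((Formula.eq t u).imp ((Formula.eq u w).imp (Formula.eq t w)))
  | eqSucc (t u : Term) :
      LogicalAxiom ((Formula.eq t u).imp (Formula.eq t.succ u.succ))
  | eqAdd (t₁ t₂ u₁ u₂ : Term) :
      LogicalAxiom ((Formula.eq t₁ t₂).imp ((Formula.eq u₁ u₂).imp
        (Formula.eq (t₁.add u₁) (t₂.add u₂))))
  | eqMul (t₁ t₂ u₁ u₂ : Term) :
      LogicalAxiom ((Formula.eq t₁ t₂).imp ((Formula.eq u₁ u₂).imp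
        (Formula.eq (t₁.mul u₁) (t₂.mul u₂))))
  | eqLe (t₁ t₂ u₁ u₂ : Term) :
      LogicalAxiom ((Formula.eq t₁ t₂).imp ((Formula.eq u₁ u₂).imp
        ((Formula.le t₁ u₁).imp (Formula.le t₂ u₂))))

/-- Provability in an L_□-theory: logical axioms, the axioms of the theory, and the
rules modus ponens, generalization, and necessitation. -/
inductive Provable (T : Set Formula) : Formula → Prop
  | ax {φ : Formula} : φ ∈ T → Provable T φ
  | logic {φ : Formula} : LogicalAxiom φ → Provable T φ
  | mp {φ ψ : Formula} : Provable T (φ.imp ψ) → Provable T φ → Provable T ψ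
  | gen {φ : Formula} (x : ℕ) : Provable T φ → Provable T (Formula.all x φ)
  | nec {φ : Formula} : Provable T φ → Provable T (Formula.box φ)

/-- First-order provability (no necessitation rule); used for the non-modal theory PA. -/
inductive FOProvable (T : Set Formula) : Formula → Prop
  | ax {φ : Formula} : φ ∈ T → FOProvable T φ
  | logic {φ : Formula} : LogicalAxiom φ → FOProvable T φ
  | mp {φ ψ : Formula} : FOProvable T (φ.imp ψ) → FOProvable T φ → FOProvable T ψ
  | gen {φ : Formula} (x : ℕ) : FOProvable T φ → FOProvable T (Formula.all x φ)

/-- Basic (Robinson-style) axioms of arithmetic. -/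
def succNeZero : Formula := (Formula.eq (Term.succ (Term.var 0)) Term.zero).neg
def succInj : Formula :=
  (Formula.eq (Term.succ (Term.var 0)) (Term.succ (Term.var 1))).imp
    (Formula.eq (Term.var 0) (Term.var 1))
def addZero : Formula := Formula.eq (Term.add (Term.var 0) Term.zero) (Term.var 0)
def addSucc : Formula :=
  Formula.eq (Term.add (Term.var 0) (Term.succ (Term.var 1)))
    (Term.succ (Term.add (Term.var 0) (Term.var 1)))
def mulZero : Formula := Formula.eq (Term.mul (Term.var 0) Term.zero) Term.zero
def mulSucc : Formula :=
  Formula.eq (Term.mul (Term.var 0) (Term.succ (Term.var 1)))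
    (Term.add (Term.mul (Term.var 0) (Term.var 1)) (Term.var 0))
def leDef : Formula :=
  (Formula.le (Term.var 0) (Term.var 1)).iff
    (Formula.ex 2 (Formula.eq (Term.add (Term.var 0) (Term.var 2)) (Term.var 1)))

def baseAxioms : Set Formula :=
  {succNeZero, succInj, addZero, addSucc, mulZero, mulSucc, leDef}

/-- The induction axiom for the formula `φ` and the variable `x`. -/
def inductionAx (x : ℕ) (φ : Formula) : Formula :=
  ((φ.subst x Term.zero).and
    (Formula.all x (φ.imp (φ.subst x (Term.succ (Term.var x)))))).imp
      (Formula.all x φ)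

/-- Peano arithmetic PA: basic axioms plus induction for L_A-formulas. -/
def PA : Set Formula :=
  baseAxioms ∪ {χ | ∃ (x : ℕ) (φ : Formula), φ.noBox ∧ χ = inductionAx x φ}

/-- PA_□ : basic axioms plus induction for all L_□-formulas. -/
def PABox : Set Formula :=
  baseAxioms ∪ {χ | ∃ (x : ℕ) (φ : Formula), χ = inductionAx x φ}

/-- The distribution axiom K. -/
def axK (φ ψ : Formula) : Formula :=
  (Formula.box (φ.imp ψ)).imp ((Formula.box φ).imp (Formula.box ψ))

/-- PA(K). -/
def PAK : Set Formula := PABox ∪ {χ | ∃ φ ψ : Formula, χ = axK φ ψ}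

/-- The axiom 4. -/
def ax4 (φ : Formula) : Formula := (Formula.box φ).imp (Formula.box (Formula.box φ))

/-- PA(K4). -/
def PAK4 : Set Formula := PAK ∪ {χ | ∃ φ : Formula, χ = ax4 φ}

/-- The axiom of Triv. -/
def axTriv (φ : Formula) : Formula := (Formula.box φ).iff φ

/-- PA(Triv). -/
def PATriv : Set Formula := PAK ∪ {χ | ∃ φ : Formula, χ = axTriv φ}

/-- PA(Ver). -/
def PAVer : Set Formula := PAK ∪ {Formula.box Formula.falsum}

/-- `T` extends `U`: every axiom of `U` is provable in `T`. -/
def Extends (T U : Set Formula) : Prop := ∀ φ ∈ U, Provable T φ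

/-- Consistency. -/
def Consistent (T : Set Formula) : Prop := ¬ Provable T Formula.falsum

/-- The class Δ₀ of bounded L_A-formulas. -/
inductive IsDelta0 : Formula → Prop
  | falsum : IsDelta0 Formula.falsum
  | eq (t u : Term) : IsDelta0 (Formula.eq t u)
  | le (t u : Term) : IsDelta0 (Formula.le t u)
  | and {φ ψ : Formula} : IsDelta0 φ → IsDelta0 ψ → IsDelta0 (φ.and ψ)
  | or {φ ψ : Formula} : IsDelta0 φ → IsDelta0 ψ → IsDelta0 (φ.or ψ)
  | imp {φ ψ : Formula} : IsDelta0 φ → IsDelta0 ψ → IsDelta0 (φ.imp ψ)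
  | neg {φ : Formula} : IsDelta0 φ → IsDelta0 φ.neg
  | ball {x : ℕ} {t : Term} {φ : Formula} :
      x ∉ t.fv → IsDelta0 φ → IsDelta0 (Formula.ball x t φ)
  | bex {x : ℕ} {t : Term} {φ : Formula} :
      x ∉ t.fv → IsDelta0 φ → IsDelta0 (Formula.bex x t φ)

/-- The class Σ₁ of L_A-formulas. -/
inductive IsSigma1 : Formula → Prop
  | delta0 {φ : Formula} : IsDelta0 φ → IsSigma1 φ
  | and {φ ψ : Formula} : IsSigma1 φ → IsSigma1 ψ → IsSigma1 (φ.and ψ)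
  | or {φ ψ : Formula} : IsSigma1 φ → IsSigma1 ψ → IsSigma1 (φ.or ψ)
  | ex {x : ℕ} {φ : Formula} : IsSigma1 φ → IsSigma1 (Formula.ex x φ)
  | ball {x : ℕ} {t : Term} {φ : Formula} :
      x ∉ t.fv → IsSigma1 φ → IsSigma1 (Formula.ball x t φ)

/-- The class B of boxed formulas. -/
def IsB (φ : Formula) : Prop := ∃ ψ : Formula, φ = Formula.box ψ

/-- The class ΔB. -/
inductive IsDeltaB : Formula → Prop
  | delta0 {φ : Formula} : IsDelta0 φ → IsDeltaB φ
  | b (ψ : Formula) : IsDeltaB (Formula.box ψ)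
  | and {φ ψ : Formula} : IsDeltaB φ → IsDeltaB ψ → IsDeltaB (φ.and ψ)
  | or {φ ψ : Formula} : IsDeltaB φ → IsDeltaB ψ → IsDeltaB (φ.or ψ)
  | ball {x : ℕ} {t : Term} {φ : Formula} :
      x ∉ t.fv → IsDeltaB φ → IsDeltaB (Formula.ball x t φ)
  | bex {x : ℕ} {t : Term} {φ : Formula} :
      x ∉ t.fv → IsDeltaB φ → IsDeltaB (Formula.bex x t φ)

/-- The class ΣB. -/
inductive IsSigmaB : Formula → Prop
  | sigma1 {φ : Formula} : IsSigma1 φ → IsSigmaB φ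
  | b (ψ : Formula) : IsSigmaB (Formula.box ψ)
  | and {φ ψ : Formula} : IsSigmaB φ → IsSigmaB ψ → IsSigmaB (φ.and ψ)
  | or {φ ψ : Formula} : IsSigmaB φ → IsSigmaB ψ → IsSigmaB (φ.or ψ)
  | ex {x : ℕ} {φ : Formula} : IsSigmaB φ → IsSigmaB (Formula.ex x φ)
  | ball {x : ℕ} {t : Term} {φ : Formula} :
      x ∉ t.fv → IsSigmaB φ → IsSigmaB (Formula.ball x t φ)

/-- Iterated disjunction (the empty disjunction is ⊥). -/
def disj : List Formula → Formula
  | [] => Formula.falsum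
  | [φ] => φ
  | φ :: ψ :: l => φ.or (disj (ψ :: l))

/-- Iterated conjunction (the empty conjunction is ⊤). -/
def conj : List Formula → Formula
  | [] => Formula.falsum.neg
  | [φ] => φ
  | φ :: ψ :: l => φ.and (conj (ψ :: l))

/-- Γ-disjunction property. -/
def HasDP (T : Set Formula) (Γ : Formula → Prop) : Prop :=
  ∀ φ ψ : Formula, Γ φ → Γ ψ → Sentence φ → Sentence ψ →
    Provable T (φ.or ψ) → Provable T φ ∨ Provable T ψ

/-- (Γ, Θ)-disjunction property. -/
def HasDP2 (T : Set Formula) (Γ Θ : Formula → Prop) : Prop :=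
  ∀ φ ψ : Formula, Γ φ → Θ ψ → Sentence φ → Sentence ψ →
    Provable T (φ.or ψ) → Provable T φ ∨ Provable T ψ

/-- Γ-existence property. -/
def HasEP (T : Set Formula) (Γ : Formula → Prop) : Prop :=
  ∀ (x : ℕ) (φ : Formula), Γ φ → φ.fv ⊆ {x} →
    Provable T (Formula.ex x φ) → ∃ n : ℕ, Provable T (φ.subst x (Term.numeral n))

/-- Modal disjunction property. -/
def HasMDP (T : Set Formula) : Prop :=
  ∀ φ ψ : Formula, Sentence φ → Sentence ψ →
    Provable T ((Formula.box φ).or (Formula.box ψ)) → Provable T φ ∨ Provable T ψ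

/-- Modal existence property. -/
def HasMEP (T : Set Formula) : Prop :=
  ∀ (x : ℕ) (φ : Formula), φ.fv ⊆ {x} →
    Provable T (Formula.ex x (Formula.box φ)) →
      ∃ n : ℕ, Provable T (φ.subst x (Term.numeral n))

/-- n-fold B-disjunction property. -/
def HasBnDP (T : Set Formula) (n : ℕ) : Prop :=
  ∀ φ : Fin n → Formula, (∀ i, Sentence (φ i)) →
    Provable T (disj (List.ofFn fun i => Formula.box (φ i))) →
    ∃ i, Provable T (Formula.box (φ i))

/-- Σ₁-soundness. -/
def Sigma1Sound (T : Set Formula) : Prop :=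
  ∀ φ : Formula, IsSigma1 φ → Sentence φ → Provable T φ → StdTrue φ

/-- L_A-soundness. -/
def LASound (T : Set Formula) : Prop :=
  ∀ φ : Formula, φ.noBox → Sentence φ → Provable T φ → StdTrue φ

/-- `T` is recursively enumerable (via the Gödel numbering of formulas). -/
def RE (T : Set Formula) : Prop :=
  Nat.Partrec fun n => Part.assert (∃ φ ∈ T, Formula.code φ = n) fun _ => Part.some 0

/-- A fixed natural Σ₁ provability predicate `Pr_T(x)` for the theory `T`:
a Σ₁ L_A-formula with only the free variable `0` which numerates provability in `T`
in the standard model and satisfies the standard derivability conditions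
(provably in PA). -/
structure ProvPred (T : Set Formula) where
  pr : Formula
  noBox : pr.noBox
  sigma1 : IsSigma1 pr
  fvSub : pr.fv ⊆ {0}
  numerates : ∀ φ : Formula,
    StdTrue (pr.subst 0 (Term.numeral φ.code)) ↔ Provable T φ
  d1 : ∀ φ : Formula, Provable T φ → FOProvable PA (pr.subst 0 (Term.numeral φ.code))
  d2 : ∀ φ ψ : Formula,
    FOProvable PA ((pr.subst 0 (Term.numeral (φ.imp ψ).code)).imp
      ((pr.subst 0 (Term.numeral φ.code)).imp (pr.subst 0 (Term.numeral ψ.code))))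
  necClosed : ∀ φ : Formula,
    FOProvable PA ((pr.subst 0 (Term.numeral φ.code)).imp
      (pr.subst 0 (Term.numeral (Formula.box φ).code)))

/-- `Pr_T(⌜φ⌝)`. -/
def ProvPred.app {T : Set Formula} (P : ProvPred T) (φ : Formula) : Formula :=
  P.pr.subst 0 (Term.numeral φ.code)

/-- Γ-disjunctive correctness (Γ-DC). -/
def DC (T : Set Formula) (P : ProvPred T) (Γ : Formula → Prop) : Prop :=
  ∀ φ : Formula, Γ φ → Sentence φ → Provable T (φ.or (P.app φ)) → Provable T φ

/-- The substitution replacing each variable by the numeral of its value. -/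
def numeralSubst (v : ℕ → ℕ) : ℕ → Term := fun x => Term.numeral (v x)

/-- Standard-model satisfaction of the ρ_T-translation: `ρ_T` is the identity on
L_A-formulas, commutes with connectives and quantifiers, and sends `□φ(x⃗)` to
`Pr_T(⌜□φ(ẋ⃗)⌝)`, whose truth in ℕ (for a natural provability predicate) amounts to
provability in `T` of `□φ(n̄⃗)`. -/
def RhoSat (T : Set Formula) : Formula → (ℕ → ℕ) → Prop
  | .falsum, _ => False
  | .eq t u, v => t.val v = u.val v
  | .le t u, v => t.val v ≤ u.val v
  | .and φ ψ, v => RhoSat T φ v ∧ RhoSat T ψ v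
  | .or φ ψ, v => RhoSat T φ v ∨ RhoSat T ψ v
  | .imp φ ψ, v => RhoSat T φ v → RhoSat T ψ v
  | .neg φ, v => ¬ RhoSat T φ v
  | .all x φ, v => ∀ n : ℕ, RhoSat T φ (Function.update v x n)
  | .ex x φ, v => ∃ n : ℕ, RhoSat T φ (Function.update v x n)
  | .box φ, v => Provable T (Formula.box (φ.substAll (numeralSubst v)))

/-- Standard-model satisfaction of the π_T-translation: `π_T` is the identity on
L_A-formulas, commutes with connectives and quantifiers, and sends `□φ(x⃗)` to
`Pr_T(⌜φ(ẋ⃗)⌝)`, whose truth in ℕ (for a natural provability predicate) amounts to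
provability in `T` of `φ(n̄⃗)`. -/
def PiSat (T : Set Formula) : Formula → (ℕ → ℕ) → Prop
  | .falsum, _ => False
  | .eq t u, v => t.val v = u.val v
  | .le t u, v => t.val v ≤ u.val v
  | .and φ ψ, v => PiSat T φ v ∧ PiSat T ψ v
  | .or φ ψ, v => PiSat T φ v ∨ PiSat T ψ v
  | .imp φ ψ, v => PiSat T φ v → PiSat T ψ v
  | .neg φ, v => ¬ PiSat T φ v
  | .all x φ, v => ∀ n : ℕ, PiSat T φ (Function.update v x n)
  | .ex x φ, v => ∃ n : ℕ, PiSat T φ (Function.update v x n)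
  | .box φ, v => Provable T (φ.substAll (numeralSubst v))

/-- Weak ΣB-soundness: every provable ΣB sentence is true in ℕ under ρ_T. -/
def WeaklySigmaBSound (T : Set Formula) : Prop :=
  ∀ φ : Formula, IsSigmaB φ → Sentence φ → Provable T φ → RhoSat T φ fun _ => 0

/-- ΣB-soundness: every provable ΣB sentence is true in ℕ under π_T. -/
def SigmaBSound (T : Set Formula) : Prop :=
  ∀ φ : Formula, IsSigmaB φ → Sentence φ → Provable T φ → PiSat T φ fun _ => 0

end ModalArith

namespace ModalArith

/-- Propositional derivability from hypotheses over PA(K). -/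
inductive Ded (Γ : List Formula) : Formula → Prop
  | hyp {φ : Formula} : φ ∈ Γ → Ded Γ φ
  | thm {φ : Formula} : Provable PAK φ → Ded Γ φ
  | mp {φ ψ : Formula} : Ded Γ (φ.imp ψ) → Ded Γ φ → Ded Γ ψ

theorem Ded.lg {Γ : List Formula} {φ : Formula} (h : LogicalAxiom φ) : Ded Γ φ :=
  .thm (.logic h)

theorem Ded.out {φ : Formula} (h : Ded [] φ) : Provable PAK φ := by
  induction h with
  | hyp h => simp at h
  | thm h => exact h
  | mp _ _ h1 h2 => exact .mp h1 h2

theorem Ded.intro {Γ : List Formula} {A B : Formula} (h : Ded (A :: Γ) B) :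
    Ded Γ (A.imp B) := by
  induction h with
  | @hyp φ h =>
    rcases List.mem_cons.1 h with rfl | h
    · exact .mp (.mp (.lg (.imp2 φ (φ.imp φ) φ)) (.lg (.imp1 _ _))) (.lg (.imp1 _ _))
    · exact .mp (.lg (.imp1 _ _)) (.hyp h)
  | thm h => exact .mp (.lg (.imp1 _ _)) (.thm h)
  | mp _ _ h1 h2 => exact .mp (.mp (.lg (.imp2 _ _ _)) h1) h2

theorem Ded.h0 {Γ : List Formula} {A : Formula} : Ded (A :: Γ) A := .hyp (by simp)
theorem Ded.h1 {Γ : List Formula} {A B : Formula} : Ded (B :: A :: Γ) A := .hyp (by simp)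
theorem Ded.h2 {Γ : List Formula} {A B C : Formula} : Ded (C :: B :: A :: Γ) A := .hyp (by simp)
theorem Ded.h3 {Γ : List Formula} {A B C D : Formula} : Ded (D :: C :: B :: A :: Γ) A :=
  .hyp (by simp)

theorem Ded.k {Γ : List Formula} {A B : Formula} (h : Ded Γ (A.imp B).box) (h' : Ded Γ A.box) :
    Ded Γ B.box :=
  .mp (.mp (.thm (.ax (Or.inr ⟨A, B, rfl⟩))) h) h'

theorem Term.substAll_id (t : Term) (v : ℕ → Term) (h : ∀ i ∈ t.fv, v i = Term.var i) :
    t.substAll v = t := by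
  induction t <;> simp_all [Term.substAll, Term.fv]

theorem Formula.substAll_id (φ : Formula) : ∀ (v : ℕ → Term) (_ : ∀ i ∈ φ.fv, v i = Term.var i),
    φ.substAll v = φ := by
  induction φ with
  | falsum => intro v h; rfl
  | eq t u =>
    intro v h
    simp only [Formula.fv, Finset.mem_union] at h
    simp only [Formula.substAll]
    rw [Term.substAll_id t v (fun i hi => h i (.inl hi)),
      Term.substAll_id u v (fun i hi => h i (.inr hi))]
  | le t u =>
    intro v h
    simp only [Formula.fv, Finset.mem_union] at h
    simp only [Formula.substAll]
    rw [Term.substAll_id t v (fun i hi => h i (.inl hi)),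
      Term.substAll_id u v (fun i hi => h i (.inr hi))]
  | and a b iha ihb | or a b iha ihb | imp a b iha ihb =>
    intro v h
    simp only [Formula.fv, Finset.mem_union] at h
    simp only [Formula.substAll]
    rw [iha v (fun i hi => h i (.inl hi)), ihb v (fun i hi => h i (.inr hi))]
  | neg a iha | box a iha =>
    intro v h
    simp only [Formula.substAll]
    rw [iha v h]
  | all z a iha | ex z a iha =>
    intro v h
    simp only [Formula.fv, Finset.mem_erase] at h
    simp only [Formula.substAll]
    rw [iha]
    intro i hi
    by_cases hz : i = z
    · subst hz; simp
    · simp [hz, h i ⟨hz, hi⟩]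

theorem spec (x : ℕ) (t : Term) {φ : Formula} (hf : φ.freeFor t x) (h : Provable PAK φ) :
    Provable PAK (φ.subst x t) :=
  .mp (.logic (.allE x t φ hf)) (.gen x h)

theorem Formula.subst_self (x : ℕ) (φ : Formula) : φ.subst x (Term.var x) = φ :=
  Formula.substAll_id _ _ (by simp)

theorem indRule (x : ℕ) (φ : Formula) (hf : φ.freeFor (Term.var x) x)
    (h0 : Provable PAK (φ.subst x Term.zero))
    (h1 : Provable PAK (φ.imp (φ.subst x (Term.succ (Term.var x))))) : Provable PAK φ := by
  have ha : Provable PAK (inductionAx x φ) := .ax (Or.inl (Or.inr ⟨x, φ, rfl⟩))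
  have hb : Provable PAK (Formula.all x φ) :=
    Ded.out (.mp (.thm ha) (.mp (.mp (.lg (.andI _ _)) (.thm h0)) (.thm (.gen x h1))))
  have := Provable.mp (.logic (.allE x (Term.var x) φ hf)) hb
  rwa [Formula.subst_self] at this

theorem pSuccNeZero (t : Term) : Provable PAK (Formula.eq (Term.succ t) Term.zero).neg := by
  have := spec 0 t (φ := succNeZero) (by simp [succNeZero, Formula.freeFor])
    (.ax (Or.inl (Or.inl (by simp [baseAxioms]))))
  simpa [succNeZero, Formula.subst, Formula.substAll, Term.substAll] using this

theorem pSuccInj : Provable PAK succInj := .ax (Or.inl (Or.inl (by simp [baseAxioms])))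

/-- `t = u → □ (t = u)`. -/
def eqBox (t u : Term) : Formula := (Formula.eq t u).imp (Formula.box (Formula.eq t u))

theorem eqBox_zero_one : Provable PAK (eqBox .zero (.var 1)) := by
  apply indRule 1
  · simp [eqBox, Formula.freeFor]
  · simp [eqBox, Formula.subst, Formula.substAll, Term.substAll]
    exact Ded.out (.intro (.thm (.nec (.logic (.eqRefl _)))))
  · simp [eqBox, Formula.subst, Formula.substAll, Term.substAll]
    refine Ded.out (.intro (.intro ?_))
    exact .mp (.mp (.lg (.negE _ _)) (.thm (pSuccNeZero (.var 1)))) (.mp (.lg (.eqSymm _ _)) .h0)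

theorem eqBox_step : Provable PAK ((Formula.all 1 (eqBox (.var 0) (.var 1))).imp
    (eqBox (.succ (.var 0)) (.var 1))) := by
  apply indRule 1
  · simp [eqBox, Formula.freeFor]
  · simp [eqBox, Formula.subst, Formula.substAll, Term.substAll]
    refine Ded.out (.intro (.intro ?_))
    exact .mp (.mp (.lg (.negE _ _)) (.thm (pSuccNeZero (.var 0)))) .h0
  · simp [eqBox, Formula.subst, Formula.substAll, Term.substAll]
    refine Ded.out (.intro (.intro (.intro ?_)))
    have ha := LogicalAxiom.allE 1 (.var 1) (eqBox (.var 0) (.var 1))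
      (by simp [eqBox, Formula.freeFor])
    rw [Formula.subst_self] at ha
    refine .k (.thm (.nec (.logic (.eqSucc _ _)))) ?_
    exact .mp (.mp (.lg ha) .h1) (.mp (.thm pSuccInj) .h0)

theorem eqBox_all : Provable PAK (Formula.all 1 (eqBox (.var 0) (.var 1))) := by
  apply indRule 0
  · simp [eqBox, Formula.freeFor, Term.fv]
  · have := Provable.gen 1 eqBox_zero_one
    simpa [eqBox, Formula.subst, Formula.substAll, Term.substAll] using this
  · have := Provable.mp (.logic (.allImp 1 _ _ (by simp [Formula.fv]))) (.gen 1 eqBox_step)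
    simpa [eqBox, Formula.subst, Formula.substAll, Term.substAll] using this

theorem eqBox_var (x y : ℕ) : Provable PAK (eqBox (.var x) (.var y)) := by
  obtain ⟨z, hz0, hzx⟩ : ∃ z : ℕ, z ≠ 0 ∧ z ≠ x := ⟨x + 1, by omega, by omega⟩
  have h1 := Provable.mp (.logic (.allE 1 (.var z) _ (by simp [eqBox, Formula.freeFor]))) eqBox_all
  have h2 := spec 0 (.var x) (by simp [eqBox, Formula.freeFor, Formula.subst, Formula.substAll]) h1
  have h3 := spec z (.var y) (by simp [eqBox, Formula.freeFor, Formula.subst, Formula.substAll]) h2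
  simpa [eqBox, Formula.subst, Formula.substAll, Term.substAll, hz0, hzx, hzx.symm] using h3

theorem term_congr (x y : ℕ) (t : Term) :
    Provable PAK ((Formula.eq (.var x) (.var y)).imp (Formula.eq t (Term.subst x (.var y) t))) := by
  apply Ded.out
  apply Ded.intro
  unfold Term.subst
  induction t with
  | var z =>
    by_cases h : z = x
    · subst h; simp only [Term.substAll, Function.update_self]; exact .h0
    · simp only [Term.substAll, ne_eq, h, not_false_eq_true, Function.update_of_ne]
      exact .lg (.eqRefl _)
  | zero => exact .lg (.eqRefl _)
  | succ t ih => exact .mp (.lg (.eqSucc _ _)) ih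
  | add t u ih1 ih2 => exact .mp (.mp (.lg (.eqAdd _ _ _ _)) ih1) ih2
  | mul t u ih1 ih2 => exact .mp (.mp (.lg (.eqMul _ _ _ _)) ih1) ih2

theorem Ded.up {Γ : List Formula} {A B : Formula} (h : Provable PAK (A.imp B)) (h' : Ded Γ A) :
    Ded Γ B := .mp (.thm h) h'

theorem Ded.idd {Γ : List Formula} {A : Formula} : Ded Γ (A.imp A) := .intro .h0

theorem all_congr {E a b : Formula} {z : ℕ} (hz : z ∉ E.fv)
    (h : Provable PAK (E.imp (a.imp b))) :
    Provable PAK (E.imp ((Formula.all z a).imp (Formula.all z b))) := by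
  have ha := LogicalAxiom.allE z (.var z) a
  have hf : ∀ a : Formula, a.freeFor (.var z) z := by
    intro a
    induction a <;> simp_all [Formula.freeFor, Term.fv]
    all_goals tauto
  specialize ha (hf a)
  rw [Formula.subst_self] at ha
  have h2 : Provable PAK ((E.and (Formula.all z a)).imp b) :=
    Ded.out (.intro (.mp (.up h (.mp (.lg (.andE1 _ _)) .h0))
      (.mp (.lg ha) (.mp (.lg (.andE2 _ _)) .h0))))
  have h3 := Provable.mp (.logic (.allImp z _ _ (by simp [Formula.fv, hz]))) (.gen z h2)
  exact Ded.out (.intro (.intro (.up h3 (.mp (.mp (.lg (.andI _ _)) .h1) .h0))))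

theorem ex_congr {E a b : Formula} {z : ℕ} (hz : z ∉ E.fv)
    (h : Provable PAK (E.imp (a.imp b))) :
    Provable PAK (E.imp ((Formula.ex z a).imp (Formula.ex z b))) := by
  have hb := LogicalAxiom.exI z (.var z) b
  have hf : ∀ a : Formula, a.freeFor (.var z) z := by
    intro a
    induction a <;> simp_all [Formula.freeFor, Term.fv]
    all_goals tauto
  specialize hb (hf b)
  rw [Formula.subst_self] at hb
  have h2 : Provable PAK (E.imp (a.imp (Formula.ex z b))) :=
    Ded.out (.intro (.intro (.mp (.lg hb) (.mp (.up h .h1) .h0))))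
  have h3 := Provable.mp (.logic (.allImp z _ _ hz)) (.gen z h2)
  exact Ded.out (.intro (.mp (.lg (.exE z _ _ (by simp [Formula.fv]))) (.up h3 .h0)))

theorem box_congr {x y : ℕ} {a b : Formula}
    (h : Provable PAK ((Formula.eq (.var x) (.var y)).imp (a.imp b))) :
    Provable PAK ((Formula.eq (.var x) (.var y)).imp (a.box.imp b.box)) :=
  Ded.out (.intro (.intro (.k (.k (.thm (.nec h)) (.up (eqBox_var x y) .h1)) .h0)))

theorem subst_quant {x y z : ℕ} (a : Formula) (h : ¬ x = z) :
    a.substAll (Function.update (Function.update Term.var x (Term.var y)) z (Term.var z))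
      = a.subst x (Term.var y) := by
  unfold Formula.subst
  congr 1
  funext i
  by_cases hi : i = z
  · subst hi; simp [Ne.symm h]
  · simp [hi]

theorem leibniz (x y : ℕ) (φ : Formula) (hf : φ.freeFor (Term.var y) x) :
    Provable PAK ((Formula.eq (.var x) (.var y)).imp (φ.imp (φ.subst x (.var y)))) ∧
    Provable PAK ((Formula.eq (.var x) (.var y)).imp ((φ.subst x (.var y)).imp φ)) := by
  have hid : ∀ ψ : Formula, ψ.subst x (.var y) = ψ →
      Provable PAK ((Formula.eq (.var x) (.var y)).imp (ψ.imp (ψ.subst x (.var y)))) ∧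
      Provable PAK ((Formula.eq (.var x) (.var y)).imp ((ψ.subst x (.var y)).imp ψ)) := by
    intro ψ h
    rw [h]
    exact ⟨Ded.out (.intro .idd), Ded.out (.intro .idd)⟩
  induction φ with
  | falsum => exact hid _ rfl
  | eq t u =>
    have ht := term_congr x y t
    have hu := term_congr x y u
    exact ⟨Ded.out (.intro (.intro (.mp (.mp (.lg (.eqTrans _ t _))
        (.mp (.lg (.eqSymm _ _)) (.up ht .h1)))
        (.mp (.mp (.lg (.eqTrans _ u _)) .h0) (.up hu .h1))))),
      Ded.out (.intro (.intro (.mp (.mp (.lg (.eqTrans _ _ _)) (.up ht .h1))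
        (.mp (.mp (.lg (.eqTrans _ _ _)) .h0) (.mp (.lg (.eqSymm _ _)) (.up hu .h1))))))⟩
  | le t u =>
    have ht := term_congr x y t
    have hu := term_congr x y u
    exact ⟨Ded.out (.intro (.mp (.mp (.lg (.eqLe _ _ _ _)) (.up ht .h0)) (.up hu .h0))),
      Ded.out (.intro (.mp (.mp (.lg (.eqLe _ _ _ _)) (.mp (.lg (.eqSymm _ _)) (.up ht .h0)))
        (.mp (.lg (.eqSymm _ _)) (.up hu .h0))))⟩
  | and a b iha ihb =>
    obtain ⟨a1, a2⟩ := iha hf.1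
    obtain ⟨b1, b2⟩ := ihb hf.2
    have key : ∀ {E a a' b b' : Formula}, Provable PAK (E.imp (a.imp a')) →
        Provable PAK (E.imp (b.imp b')) → Provable PAK (E.imp ((a.and b).imp (a'.and b'))) :=
      fun h1 h2 => Ded.out (.intro (.intro (.mp (.mp (.lg (.andI _ _))
        (.mp (.up h1 .h1) (.mp (.lg (.andE1 _ _)) .h0)))
        (.mp (.up h2 .h1) (.mp (.lg (.andE2 _ _)) .h0)))))
    exact ⟨key a1 b1, key a2 b2⟩
  | or a b iha ihb =>
    obtain ⟨a1, a2⟩ := iha hf.1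
    obtain ⟨b1, b2⟩ := ihb hf.2
    have key : ∀ {E a a' b b' : Formula}, Provable PAK (E.imp (a.imp a')) →
        Provable PAK (E.imp (b.imp b')) → Provable PAK (E.imp ((a.or b).imp (a'.or b'))) :=
      fun h1 h2 => Ded.out (.intro (.mp (.mp (.lg (.orE _ _ _))
        (.intro (.mp (.lg (.orI1 _ _)) (.mp (.up h1 .h1) .h0))))
        (.intro (.mp (.lg (.orI2 _ _)) (.mp (.up h2 .h1) .h0)))))
    exact ⟨key a1 b1, key a2 b2⟩
  | imp a b iha ihb =>
    obtain ⟨a1, a2⟩ := iha hf.1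
    obtain ⟨b1, b2⟩ := ihb hf.2
    have key : ∀ {E a a' b b' : Formula}, Provable PAK (E.imp (a'.imp a)) →
        Provable PAK (E.imp (b.imp b')) → Provable PAK (E.imp ((a.imp b).imp (a'.imp b'))) :=
      fun h1 h2 => Ded.out (.intro (.intro (.intro
        (.mp (.up h2 .h2) (.mp .h1 (.mp (.up h1 .h2) .h0))))))
    exact ⟨key a2 b1, key a1 b2⟩
  | neg a iha =>
    obtain ⟨a1, a2⟩ := iha hf
    have key : ∀ {E a a' : Formula}, Provable PAK (E.imp (a'.imp a)) →
        Provable PAK (E.imp (a.neg.imp a'.neg)) :=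
      fun h1 => Ded.out (.intro (.intro (.mp (.lg (.negIntro _)) (.intro
        (.mp (.mp (.lg (.negElimFalsum _)) .h1) (.mp (.up h1 .h2) .h0))))))
    exact ⟨key a2, key a1⟩
  | all z a iha =>
    by_cases hxz : x = z
    · apply hid
      apply Formula.substAll_id
      intro i hi
      simp only [Formula.fv, Finset.mem_erase] at hi
      rw [Function.update_of_ne (by rw [hxz]; exact hi.1)]
    rcases hf with h | h | ⟨h1, h2⟩
    · exact absurd h hxz
    · apply hid
      apply Formula.substAll_id
      intro i hi
      simp only [Formula.fv, Finset.mem_erase] at hi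
      rw [Function.update_of_ne (by rintro rfl; exact h hi.2)]
    · have hz : z ∉ (Formula.eq (.var x) (.var y)).fv := by
        simp only [Term.fv, Finset.mem_singleton] at h1
        simp [Formula.fv, Term.fv, h1, Ne.symm hxz]
      have e : (Formula.all z a).subst x (.var y) = Formula.all z (a.subst x (.var y)) := by
        conv_lhs => unfold Formula.subst
        simp only [Formula.substAll, subst_quant a hxz]
      rw [e]
      exact ⟨all_congr hz (iha h2).1, all_congr hz (iha h2).2⟩
  | ex z a iha =>
    by_cases hxz : x = z
    · apply hid
      apply Formula.substAll_id
      intro i hi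
      simp only [Formula.fv, Finset.mem_erase] at hi
      rw [Function.update_of_ne (by rw [hxz]; exact hi.1)]
    rcases hf with h | h | ⟨h1, h2⟩
    · exact absurd h hxz
    · apply hid
      apply Formula.substAll_id
      intro i hi
      simp only [Formula.fv, Finset.mem_erase] at hi
      rw [Function.update_of_ne (by rintro rfl; exact h hi.2)]
    · have hz : z ∉ (Formula.eq (.var x) (.var y)).fv := by
        simp only [Term.fv, Finset.mem_singleton] at h1
        simp [Formula.fv, Term.fv, h1, Ne.symm hxz]
      have e : (Formula.ex z a).subst x (.var y) = Formula.ex z (a.subst x (.var y)) := by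
        conv_lhs => unfold Formula.subst
        simp only [Formula.substAll, subst_quant a hxz]
      rw [e]
      exact ⟨ex_congr hz (iha h2).1, ex_congr hz (iha h2).2⟩
  | box a iha =>
    obtain ⟨a1, a2⟩ := iha hf
    exact ⟨box_congr a1, box_congr a2⟩

/-- (1) PA(K) ⊢ x = y → □(x = y).
(2) For every L_□-formula φ (with y substitutable for x in φ),
PA(K) ⊢ x = y → (φ(x) → φ(y)). -/
theorem statement0 :
    (∀ x y : ℕ,
      Provable PAK ((Formula.eq (Term.var x) (Term.var y)).imp
        (Formula.box (Formula.eq (Term.var x) (Term.var y))))) ∧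
    (∀ (φ : Formula) (x y : ℕ), φ.freeFor (Term.var y) x →
      Provable PAK ((Formula.eq (Term.var x) (Term.var y)).imp
        (φ.imp (φ.subst x (Term.var y))))) :=
  ⟨eqBox_var, fun φ x y h => (leibniz x y φ h).1⟩

end ModalArith
end

section
/- PA(Triv) is a conservative extension of PA: for every L_A-sentence φ, if PA(Triv) ⊢ φ then PA ⊢ φ. In particular, PA(Triv) is L_A-sound, i.e., every L_A-sentence provable in PA(Triv) is true in the standard model ℕ. -/
namespace ModalArith

/-- Erase all boxes. -/
def Formula.erase : Formula → Formula
  | .falsum => .falsum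
  | .eq t u => .eq t u
  | .le t u => .le t u
  | .and φ ψ => .and (erase φ) (erase ψ)
  | .or φ ψ => .or (erase φ) (erase ψ)
  | .imp φ ψ => .imp (erase φ) (erase ψ)
  | .neg φ => .neg (erase φ)
  | .all x φ => .all x (erase φ)
  | .ex x φ => .ex x (erase φ)
  | .box φ => erase φ

theorem erase_noBox (φ : Formula) : φ.erase.noBox := by
  induction φ <;> simp_all [Formula.erase, Formula.noBox]

theorem erase_of_noBox (φ : Formula) (h : φ.noBox) : φ.erase = φ := by
  induction φ <;> simp_all [Formula.erase, Formula.noBox]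

theorem erase_fv (φ : Formula) : φ.erase.fv = φ.fv := by
  induction φ <;> simp_all [Formula.erase, Formula.fv]

theorem erase_substAll (φ : Formula) (v : ℕ → Term) :
    (φ.substAll v).erase = φ.erase.substAll v := by
  induction φ generalizing v <;> simp_all [Formula.erase, Formula.substAll]

theorem erase_subst (φ : Formula) (x : ℕ) (t : Term) :
    (φ.subst x t).erase = φ.erase.subst x t := erase_substAll _ _

theorem erase_freeFor (φ : Formula) (x : ℕ) (t : Term) (h : φ.freeFor t x) :
    φ.erase.freeFor t x := by
  induction φ <;> simp_all [Formula.erase, Formula.freeFor, erase_fv]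
  all_goals tauto

theorem erase_logic {φ : Formula} (h : LogicalAxiom φ) : LogicalAxiom φ.erase := by
  cases h <;> simp only [Formula.erase, erase_subst]
  case allE x t φ h => exact .allE _ _ _ (erase_freeFor _ _ _ h)
  case exI x t φ h => exact .exI _ _ _ (erase_freeFor _ _ _ h)
  case allImp x φ ψ h => exact .allImp _ _ _ (by rwa [erase_fv])
  case exE x φ ψ h => exact .exE _ _ _ (by rwa [erase_fv])
  all_goals constructor

theorem fo_id (T : Set Formula) (φ : Formula) : FOProvable T (φ.imp φ) :=
  .mp (.mp (.logic (.imp2 φ (φ.imp φ) φ)) (.logic (.imp1 _ _))) (.logic (.imp1 _ _))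

theorem erase_base {φ : Formula} (h : φ ∈ baseAxioms) : φ.erase = φ := by
  apply erase_of_noBox
  rcases h with h | h | h | h | h | h | h <;> subst h <;>
    simp [succNeZero, succInj, addZero, addSucc, mulZero, mulSucc, leDef, Formula.noBox,
      Formula.iff]

theorem erase_provable {φ : Formula} (h : Provable PATriv φ) : FOProvable PA φ.erase := by
  induction h with
  | ax h =>
    rcases h with ((h | ⟨x, φ, rfl⟩) | ⟨φ, ψ, rfl⟩) | ⟨φ, rfl⟩
    · rw [erase_base h]; exact .ax (Or.inl h)
    · refine .ax (Or.inr ⟨x, φ.erase, erase_noBox _, ?_⟩)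
      simp [inductionAx, Formula.erase, erase_subst]
    · exact fo_id _ _
    · exact .mp (.mp (.logic (.andI _ _)) (fo_id _ _)) (fo_id _ _)
  | logic h => exact .logic (erase_logic h)
  | mp _ _ h1 h2 => exact .mp h1 h2
  | gen x _ h => exact .gen x h
  | nec _ h => exact h

theorem term_val_substAll (t : Term) (σ : ℕ → Term) (v : ℕ → ℕ) :
    (t.substAll σ).val v = t.val (fun x => (σ x).val v) := by
  induction t <;> simp_all [Term.substAll, Term.val]

theorem term_val_congr (t : Term) (v w : ℕ → ℕ) (h : ∀ x ∈ t.fv, v x = w x) :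
    t.val v = t.val w := by
  induction t <;> simp_all [Term.fv, Term.val]

theorem val_congr (φ : Formula) (v w : ℕ → ℕ) (h : ∀ x ∈ φ.fv, v x = w x) :
    φ.val v ↔ φ.val w := by
  induction φ generalizing v w with
  | falsum => simp [Formula.val]
  | box => simp [Formula.val]
  | eq t u =>
    simp only [Formula.val]
    rw [term_val_congr t v w fun x hx => h x (by simp [Formula.fv, hx]),
      term_val_congr u v w fun x hx => h x (by simp [Formula.fv, hx])]
  | le t u =>
    simp only [Formula.val]
    rw [term_val_congr t v w fun x hx => h x (by simp [Formula.fv, hx]),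
      term_val_congr u v w fun x hx => h x (by simp [Formula.fv, hx])]
  | and a b iha ihb | or a b iha ihb | imp a b iha ihb =>
    simp only [Formula.val]
    rw [iha v w fun x hx => h x (by simp [Formula.fv, hx]),
      ihb v w fun x hx => h x (by simp [Formula.fv, hx])]
  | neg a iha =>
    simp only [Formula.val]
    rw [iha v w fun x hx => h x (by simp [Formula.fv, hx])]
  | all y a iha =>
    simp only [Formula.val]
    refine forall_congr' fun n => iha _ _ fun x hx => ?_
    by_cases hxy : x = y
    · subst hxy; simp
    · simpa [hxy] using h x (by simp [Formula.fv, hx, hxy])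
  | ex y a iha =>
    simp only [Formula.val]
    refine exists_congr fun n => iha _ _ fun x hx => ?_
    by_cases hxy : x = y
    · subst hxy; simp
    · simpa [hxy] using h x (by simp [Formula.fv, hx, hxy])

theorem term_substAll_id (t : Term) (σ : ℕ → Term) (h : ∀ x ∈ t.fv, σ x = .var x) :
    t.substAll σ = t := by
  induction t <;> simp_all [Term.fv, Term.substAll]

theorem substAll_id (φ : Formula) (σ : ℕ → Term) (h : ∀ x ∈ φ.fv, σ x = .var x) :
    φ.substAll σ = φ := by
  induction φ generalizing σ with
  | falsum => rfl
  | box a iha => simp only [Formula.substAll]; rw [iha σ h]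
  | eq t u | le t u =>
    simp only [Formula.substAll]
    rw [term_substAll_id t σ fun x hx => h x (by simp [Formula.fv, hx]),
      term_substAll_id u σ fun x hx => h x (by simp [Formula.fv, hx])]
  | and a b iha ihb | or a b iha ihb | imp a b iha ihb =>
    simp only [Formula.substAll]
    rw [iha σ fun x hx => h x (by simp [Formula.fv, hx]),
      ihb σ fun x hx => h x (by simp [Formula.fv, hx])]
  | neg a iha =>
    simp only [Formula.substAll]; rw [iha σ h]
  | all y a iha | ex y a iha =>
    simp only [Formula.substAll]
    rw [iha]
    intro x hx
    by_cases hxy : x = y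
    · subst hxy; simp
    · simpa [hxy] using h x (by simp [Formula.fv, hx, hxy])

theorem val_update_term (x : ℕ) (s : Term) (v : ℕ → ℕ) :
    (fun y => (Function.update Term.var x s y).val v) = Function.update v x (s.val v) := by
  funext y
  by_cases h : y = x
  · subst h; simp
  · simp [h, Term.val]

/-- The quantifier step of the substitution lemma. -/
theorem val_subst_step (y x : ℕ) (s : Term) (a : Formula)
    (iha : ∀ v, a.freeFor s x → ((a.subst x s).val v ↔ a.val (Function.update v x (s.val v))))
    (h : x = y ∨ x ∉ a.fv ∨ (y ∉ s.fv ∧ a.freeFor s x)) (v : ℕ → ℕ) (n : ℕ) :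
    (a.substAll (Function.update (Function.update Term.var x s) y (Term.var y))).val
      (Function.update v y n) ↔
    a.val (Function.update (Function.update v x (s.val v)) y n) := by
  by_cases hxy : x = y
  · subst hxy
    rw [substAll_id]
    · simp
    · intro z _; by_cases hz : z = x
      · subst hz; simp
      · simp [hz]
  · by_cases hx : x ∈ a.fv
    · obtain ⟨hy, hf⟩ : y ∉ s.fv ∧ a.freeFor s x := by tauto
      have e : Function.update (Function.update Term.var x s) y (Term.var y) =
          Function.update Term.var x s := by
        funext z
        by_cases hz : z = y
        · subst hz; simp [Ne.symm hxy]
        · simp [hz]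
      rw [e]
      have := iha (Function.update v y n) hf
      rw [Formula.subst] at this
      rw [this, term_val_congr s (Function.update v y n) v, Function.update_comm hxy]
      intro z hz
      have : z ≠ y := by rintro rfl; exact hy hz
      simp [this]
    · rw [substAll_id]
      · apply val_congr
        intro z hz
        have : z ≠ x := by rintro rfl; exact hx hz
        by_cases hzy : z = y
        · subst hzy; simp
        · simp [hzy, this]
      · intro z hz
        have : z ≠ x := by rintro rfl; exact hx hz
        by_cases hzy : z = y
        · subst hzy; simp
        · simp [hzy, this]

theorem val_subst (φ : Formula) (x : ℕ) (s : Term) (v : ℕ → ℕ) (h : φ.freeFor s x) :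
    (φ.subst x s).val v ↔ φ.val (Function.update v x (s.val v)) := by
  induction φ generalizing v with
  | falsum => rfl
  | box => rfl
  | eq t u | le t u =>
    simp only [Formula.subst, Formula.substAll, Formula.val, term_val_substAll, val_update_term]
  | and a b iha ihb | or a b iha ihb | imp a b iha ihb =>
    have h1 := iha v h.1
    have h2 := ihb v h.2
    simp only [Formula.subst, Formula.substAll, Formula.val] at *
    rw [h1, h2]
  | neg a iha =>
    have h1 := iha v h
    simp only [Formula.subst, Formula.substAll, Formula.val] at *
    rw [h1]
  | all y a iha =>
    exact forall_congr' fun n => val_subst_step y x s a iha h v n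
  | ex y a iha =>
    exact exists_congr fun n => val_subst_step y x s a iha h v n

theorem logic_sound {φ : Formula} (h : LogicalAxiom φ) (v : ℕ → ℕ) : φ.val v := by
  cases h
  case allE x t φ h =>
    intro h1; rw [val_subst _ _ _ _ h]; exact h1 _
  case exI x t φ h =>
    intro h1; rw [val_subst _ _ _ _ h] at h1; exact ⟨_, h1⟩
  case allImp x φ ψ h =>
    intro h1 h2 n
    refine h1 n ((val_congr φ _ _ ?_).2 h2)
    intro z hz
    have : z ≠ x := by rintro rfl; exact h hz
    simp [this]
  case exE x φ ψ h =>
    rintro h1 ⟨n, h2⟩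
    refine (val_congr ψ _ _ ?_).1 (h1 n h2)
    intro z hz
    have : z ≠ x := by rintro rfl; exact h hz
    simp [this]
  all_goals simp only [Formula.val, Term.val]
  all_goals first
    | tauto
    | (intros; simp_all)

theorem freeFor_of_fv (φ : Formula) (x : ℕ) (s : Term) (h : s.fv ⊆ {x}) :
    φ.freeFor s x := by
  have key : ∀ y, x = y ∨ y ∉ s.fv := by
    intro y
    by_cases hy : y ∈ s.fv
    · exact Or.inl (Finset.mem_singleton.1 (h hy)).symm
    · exact Or.inr hy
  clear h
  induction φ with
  | falsum | eq | le => trivial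
  | and _ _ h1 h2 | or _ _ h1 h2 | imp _ _ h1 h2 => exact ⟨h1, h2⟩
  | neg _ h | box _ h => exact h
  | all y _ h | ex y _ h =>
    rcases key y with hy | hy
    · exact Or.inl hy
    · exact Or.inr (Or.inr ⟨hy, h⟩)

theorem sound {φ : Formula} (h : FOProvable PA φ) (v : ℕ → ℕ) : φ.val v := by
  induction h generalizing v with
  | ax h =>
    rcases h with h | ⟨x, φ, -, rfl⟩
    · rcases h with h | h | h | h | h | h | h <;> subst h <;>
        simp [succNeZero, succInj, addZero, addSucc, mulZero, mulSucc, leDef, Formula.val,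
          Formula.iff, Term.val]
      · ring
      · ring
      · exact ⟨fun h => ⟨_, Nat.add_sub_of_le h⟩, fun n h => by omega⟩
    · rintro ⟨h0, hs⟩ n
      rw [val_subst _ _ _ _ (freeFor_of_fv _ _ _ (by simp [Term.fv]))] at h0
      induction n with
      | zero => exact h0
      | succ n ih =>
        have := hs n ih
        rw [val_subst _ _ _ _ (freeFor_of_fv _ _ _ (by simp [Term.fv]))] at this
        simpa [Term.val] using this
  | logic h => exact logic_sound h v
  | mp _ _ h1 h2 => exact h1 v (h2 v)
  | gen x _ h => exact fun n => h _

/-- PA(Triv) is a conservative extension of PA; in particular PA(Triv) is L_A-sound. -/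
theorem statement1 :
    (∀ φ : Formula, φ.noBox → Sentence φ → Provable PATriv φ → FOProvable PA φ) ∧
    LASound PATriv := by
  have key : ∀ φ : Formula, φ.noBox → Sentence φ → Provable PATriv φ → FOProvable PA φ := by
    intro φ hb _ h
    have := erase_provable h
    rwa [erase_of_noBox φ hb] at this
  exact ⟨key, fun φ hb hs h => sound (key φ hb hs h) _⟩

end ModalArith
end
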